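/- There exists a set of 10073479745 four-dimensional subspaces of F_2^{15} whose pairwise subspace distance is at least 4; that is, A_2(15,4,4) ≥ 10073479745. -/

import Mathlib

/-- The subspace distance `d_S(U,W) = 2·dim(U+W) − dim U − dim W` between two
subspaces of an `F`-vector space. -/
noncomputable def subspaceDist {F V : Type*} [Field F] [AddCommGroup V] [Module F V]
    (U W : Submodule F V) : ℕ :=
  2 * Module.finrank F ↥(U ⊔ W) - Module.finrank F ↥U - Module.finrank F ↥W

/-- The row space `im(A)` of a matrix `A`, i.e. the span of its rows. -/
def rowSpace {F : Type*} [Field F] {k n : ℕ} (A : Matrix (Fin k) (Fin n) F) :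
    Submodule F (Fin n → F) :=
  Submodule.span F (Set.range fun i : Fin k => A i)

/-- Horizontal concatenation `(U | M)` of two matrices with the same number of rows. -/
def hcat {F : Type*} [Field F] {k n1 n2 : ℕ} (U : Matrix (Fin k) (Fin n1) F)
    (M : Matrix (Fin k) (Fin n2) F) : Matrix (Fin k) (Fin (n1 + n2)) F :=
  Matrix.of fun i => Fin.append (U i) (M i)

/-- The projection of `F^(n1+n2)` onto the first `n1` coordinates. -/
noncomputable def proj1 (F : Type*) [Field F] (n1 n2 : ℕ) :
    (Fin (n1 + n2) → F) →ₗ[F] (Fin n1 → F) :=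
  LinearMap.funLeft F F (Fin.castAdd n2)

/-- The vector of `F_2^4` whose coordinates are the binary digits of `n`. -/
def bitVector (n : ℕ) : Fin 4 → ZMod 2 := fun k => if n.testBit k then 1 else 0

/-- The linear map `(x, y) ↦ x a + y b`. -/
def pairMap {V : Type*} [AddCommGroup V] [Module (ZMod 2) V] (a b : V) :
    (ZMod 2 × ZMod 2) →ₗ[ZMod 2] V where
  toFun s := s.1 • a + s.2 • b
  map_add' s t := by simp only [Prod.fst_add, Prod.snd_add, add_smul]; abel
  map_smul' c s := by simp [mul_smul]

/-- Generators of the lines of a parallelism of `PG(3, 2)`: seven spreads of five lines. -/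
def lineGens : Fin 7 → Fin 5 → ℕ × ℕ :=
  ![![(1, 2), (4, 8), (5, 10), (6, 11), (7, 9)],
    ![(1, 4), (2, 8), (3, 13), (6, 9), (7, 11)],
    ![(1, 6), (2, 9), (3, 12), (4, 10), (5, 8)],
    ![(1, 8), (2, 12), (3, 5), (4, 11), (7, 10)],
    ![(1, 10), (2, 13), (3, 4), (5, 9), (6, 8)],
    ![(1, 12), (2, 4), (3, 9), (5, 11), (7, 8)],
    ![(1, 14), (2, 5), (3, 8), (4, 9), (6, 10)]]

/-- A parametrization of the `j`-th line of the `i`-th spread. -/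
def lineMap (i : Fin 7) (j : Fin 5) : (ZMod 2 × ZMod 2) →ₗ[ZMod 2] (Fin 4 → ZMod 2) :=
  pairMap (bitVector (lineGens i j).1) (bitVector (lineGens i j).2)

/-- The four elements of a field of order four inside the `2 × 2` matrices, acting on pairs. -/
def quadMap : Fin 4 → (ZMod 2 × ZMod 2) →ₗ[ZMod 2] (ZMod 2 × ZMod 2) :=
  ![pairMap 0 0, pairMap (1, 0) (0, 1), pairMap (0, 1) (1, 1), pairMap (1, 1) (1, 0)]

/-- Representatives of four maps into the quotient by the line `lineMap i k`. -/
def cosetMap (i : Fin 7) (k : Fin 5) (m : Fin 4) :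
    (ZMod 2 × ZMod 2) →ₗ[ZMod 2] (Fin 4 → ZMod 2) :=
  lineMap i (k + 1) ∘ₗ quadMap m

/-- The nonzero points of `F_2^4`. -/
def point (p : Fin 15) : Fin 4 → ZMod 2 := bitVector (p + 1)

/-- The images of the two generators of a line under `planeMap`. -/
def planeGens : Fin 15 → ℕ × ℕ :=
  ![(6, 3), (15, 0), (3, 13), (13, 12), (13, 14), (10, 5), (5, 15), (4, 6), (0, 10), (12, 7),
    (0, 15), (3, 15), (7, 11), (9, 1), (0, 7)]

/-- For each point, a map into its quotient that avoids the maps `cosetMap`. -/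
def planeMap (p : Fin 15) : (ZMod 2 × ZMod 2) →ₗ[ZMod 2] (Fin 4 → ZMod 2) :=
  pairMap (bitVector (planeGens p).1) (bitVector (planeGens p).2)

theorem lineMap_eq_zero : ∀ i j s, lineMap i j s = 0 → s = 0 := by decide +kernel
theorem lineMap_spread : ∀ i j k, j ≠ k → ∀ s t, lineMap i j s = lineMap i k t → s = 0 := by
  decide +kernel
theorem lineMap_parallelism : ∀ i j, i ≠ j → ∀ k l, ∃ s, ∀ t, lineMap i k s ≠ lineMap j l t := by
  decide +kernel
theorem cosetMap_rank : ∀ i k m n, m ≠ n → ∀ s t,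
    cosetMap i k m s = cosetMap i k n s + lineMap i k t → s = 0 := by
  decide +kernel
theorem planeMap_uncovered : ∀ p k t, lineMap 0 k t = point p →
    ∀ m, ∃ s, ∀ t, planeMap p s ≠ cosetMap 0 k m s + lineMap 0 k t := by
  decide +kernel
theorem point_independent : ∀ p q, p ≠ q → ∀ x y : ZMod 2, x • point p = y • point q → x = 0 := by
  decide +kernel
theorem point_ne_zero : ∀ p, point p ≠ 0 := by decide +kernel
theorem planeMap_separated : ∀ p q, p ≠ q → ∃ s, ∀ x y : ZMod 2,
    planeMap p s + x • point p ≠ planeMap q s + y • point q := by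
  decide +kernel

open Module

section General

variable {K V W : Type*} [Field K] [AddCommGroup V] [Module K V] [FiniteDimensional K V]
  [AddCommGroup W] [Module K W]

theorem finrank_eq_map_add_inf_ker (g : V →ₗ[K] W) (Z : Submodule K V) :
    finrank K Z = finrank K (Z.map g) + finrank K ↥(Z ⊓ LinearMap.ker g) := by
  have h := LinearMap.finrank_range_add_finrank_ker (g.domRestrict Z)
  rw [LinearMap.range_domRestrict, LinearMap.ker_domRestrict,
    ← Submodule.finrank_map_subtype_eq, Submodule.map_comap_subtype] at h
  exact h.symm

theorem finrank_le_of_map_le_of_inf_ker_le [FiniteDimensional K W] {g : V →ₗ[K] W}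
    {Z B : Submodule K V} {A : Submodule K W} (hA : Z.map g ≤ A)
    (hB : Z ⊓ LinearMap.ker g ≤ B) : finrank K Z ≤ finrank K A + finrank K B := by
  rw [finrank_eq_map_add_inf_ker g Z]
  exact add_le_add (Submodule.finrank_mono hA) (Submodule.finrank_mono hB)

theorem finrank_inf_lt {X Y : Submodule K V} (h : ¬ X ≤ Y) :
    finrank K ↥(X ⊓ Y) < finrank K X :=
  Submodule.finrank_lt_finrank_of_lt (inf_lt_left.2 h)

end General

/-- Four-dimensional subspaces, distinct indices giving subspaces that meet in dimension at most
two. -/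
def IsCode {ι V : Type*} [AddCommGroup V] [Module (ZMod 2) V]
    (X : ι → Submodule (ZMod 2) V) : Prop :=
  (∀ i, finrank (ZMod 2) (X i) = 4) ∧ ∀ i j, i ≠ j → finrank (ZMod 2) ↥(X i ⊓ X j) ≤ 2

theorem IsCode.sum {ι κ V : Type*} [AddCommGroup V] [Module (ZMod 2) V]
    {X : ι → Submodule (ZMod 2) V} {Y : κ → Submodule (ZMod 2) V} (hX : IsCode X) (hY : IsCode Y)
    (h : ∀ i j, finrank (ZMod 2) ↥(X i ⊓ Y j) ≤ 2) : IsCode (Sum.elim X Y) := by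
  refine ⟨by rintro (i | i); exacts [hX.1 i, hY.1 i], ?_⟩
  rintro (i | i) (j | j) hij
  · exact hX.2 i j fun h => hij (h ▸ rfl)
  · exact h i j
  · rw [inf_comm]; exact h j i
  · exact hY.2 i j fun h => hij (h ▸ rfl)

/-- Gabidulin codes: linear maps `x ↦ a x + b x ^ 2 + c x ^ 4` differ by maps of corank at most
two. -/
theorem exists_rankCode (W E : Type*) [AddCommGroup W] [Module (ZMod 2) W]
    [FiniteDimensional (ZMod 2) W] [AddCommGroup E] [Module (ZMod 2) E]
    [FiniteDimensional (ZMod 2) E] {m : ℕ} (hm : finrank (ZMod 2) E = m) (h0 : m ≠ 0)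
    (h : finrank (ZMod 2) W ≤ m) :
    ∃ R : Fin (2 ^ (3 * m)) → W →ₗ[ZMod 2] E,
      ∀ i j, i ≠ j → finrank (ZMod 2) (LinearMap.ker (R i - R j)) ≤ 2 := by
  let K := GaloisField 2 m
  have hK : finrank (ZMod 2) K = m := GaloisField.finrank 2 h0
  have : Fintype K := Fintype.ofFinite K
  have hcard : Fintype.card (K × K × K) = 2 ^ (3 * m) := by
    have : Fintype.card K = 2 ^ m := by rw [← Nat.card_eq_fintype_card, GaloisField.card 2 m h0]
    simp only [Fintype.card_prod, this]; ring
  have : DecidableEq K := Classical.decEq K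
  obtain ⟨φ, hφ⟩ : ∃ φ : W →ₗ[ZMod 2] K, Function.Injective φ :=
    finrank_le_iff_exists_linearMap.1 (h.trans_eq hK.symm)
  let ψ : K ≃ₗ[ZMod 2] E := LinearEquiv.ofFinrankEq K E (hK.trans hm.symm)
  let e := (Fintype.equivFinOfCardEq hcard).symm
  let σ : K →ₗ[ZMod 2] K := (FiniteField.frobeniusAlgHom (ZMod 2) K).toLinearMap
  have hσ (x : K) : σ x = x ^ 2 := by simp [σ, FiniteField.frobeniusAlgHom]
  let P (v : K × K × K) : K →ₗ[ZMod 2] K :=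
    LinearMap.mulLeft (ZMod 2) v.1 + LinearMap.mulLeft (ZMod 2) v.2.1 ∘ₗ σ +
      LinearMap.mulLeft (ZMod 2) v.2.2 ∘ₗ σ ∘ₗ σ
  have hP (v : K × K × K) (x : K) : P v x = v.1 * x + v.2.1 * x ^ 2 + v.2.2 * x ^ 4 := by
    simp [P, hσ, ← pow_mul]
  refine ⟨fun i => ψ.toLinearMap ∘ₗ P (e i) ∘ₗ φ, fun i j hij => ?_⟩
  let v := e i - e j
  have hv : v ≠ 0 := sub_ne_zero.2 (e.injective.ne hij)
  let p : Polynomial K := .C v.1 * .X + .C v.2.1 * .X ^ 2 + .C v.2.2 * .X ^ 4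
  have hp : p ≠ 0 := by
    intro h
    have h1 := congrArg (Polynomial.coeff · 1) h
    have h2 := congrArg (Polynomial.coeff · 2) h
    have h4 := congrArg (Polynomial.coeff · 4) h
    simp [p, Polynomial.coeff_X_pow] at h1 h2 h4
    exact hv (Prod.ext h1 (Prod.ext h2 h4))
  have hdeg : p.natDegree ≤ 4 := by
    simp only [p]; compute_degree
  let N := LinearMap.ker (ψ.toLinearMap ∘ₗ P (e i) ∘ₗ φ - ψ.toLinearMap ∘ₗ P (e j) ∘ₗ φ)
  have hroot (w : N) : φ w ∈ p.roots.toFinset := by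
    have hw := w.2
    simp only [N, LinearMap.mem_ker, LinearMap.sub_apply, LinearMap.comp_apply,
      LinearEquiv.coe_coe, ← map_sub, hP, EmbeddingLike.map_eq_zero_iff] at hw
    simp only [Multiset.mem_toFinset, Polynomial.mem_roots hp, Polynomial.IsRoot.def, p, v]
    simp
    linear_combination hw
  have hle : Nat.card N ≤ 4 := by
    have : Nat.card N ≤ Nat.card p.roots.toFinset :=
      Nat.card_le_card_of_injective (fun w : N => (⟨φ w, hroot w⟩ : p.roots.toFinset))
        fun a b hab => Subtype.ext (hφ (Subtype.ext_iff.1 hab))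
    rw [Nat.card_eq_fintype_card (α := p.roots.toFinset), Fintype.card_coe] at this
    exact this.trans ((Multiset.toFinset_card_le _).trans ((Polynomial.card_roots' p).trans hdeg))
  have : Nat.card N = 2 ^ finrank (ZMod 2) N := by
    rw [Module.natCard_eq_pow_finrank (K := ZMod 2), Nat.card_zmod]
  rw [this] at hle
  exact (Nat.pow_le_pow_iff_right (by norm_num : 1 < 2)).1 (hle.trans_eq (by norm_num))

section Linkage

variable {V E P : Type*} [AddCommGroup V] [Module (ZMod 2) V] [AddCommGroup E] [Module (ZMod 2) E]
  [AddCommGroup P] [Module (ZMod 2) P]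

/-- The graph of a linear map defined on a subspace. -/
def graphOn (c : Submodule (ZMod 2) V) (f : c →ₗ[ZMod 2] E) : Submodule (ZMod 2) (V × E) :=
  LinearMap.range (c.subtype.prod f)

theorem graphOn_map_fst (c : Submodule (ZMod 2) V) (f : c →ₗ[ZMod 2] E) :
    (graphOn c f).map (LinearMap.fst (ZMod 2) V E) = c := by
  rw [graphOn, ← LinearMap.range_comp, LinearMap.fst_prod, Submodule.range_subtype]

theorem graphOn_inf_ker_fst (c : Submodule (ZMod 2) V) (f : c →ₗ[ZMod 2] E) :
    graphOn c f ⊓ LinearMap.ker (LinearMap.fst (ZMod 2) V E) = ⊥ := by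
  rw [eq_bot_iff]
  rintro _ ⟨⟨w, rfl⟩, hw⟩
  have : w = 0 := Subtype.ext hw
  simp [this]

theorem finrank_graphOn (c : Submodule (ZMod 2) V) (f : c →ₗ[ZMod 2] E) :
    finrank (ZMod 2) (graphOn c f) = finrank (ZMod 2) c :=
  LinearMap.finrank_range_of_inj fun _ _ h => Subtype.ext (congrArg Prod.fst h)

theorem finrank_range_inf_range_le [FiniteDimensional (ZMod 2) P] {a b : P →ₗ[ZMod 2] V}
    {N : Submodule (ZMod 2) P} (h : ∀ v w, a v = b w → w ∈ N) :
    finrank (ZMod 2) ↥(LinearMap.range a ⊓ LinearMap.range b) ≤ finrank (ZMod 2) N := by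
  have hle : LinearMap.range a ⊓ LinearMap.range b ≤ N.map b := by
    rintro _ ⟨⟨v, rfl⟩, ⟨w, hw⟩⟩
    exact ⟨w, h v w hw.symm, hw⟩
  exact (Submodule.finrank_mono hle).trans (Submodule.finrank_map_le _ _)

/-- The space of all `(f v, s, g (v, s))`: it meets the last two factors in a point and projects
onto the range of `f`. -/
def pointLift (f : P →ₗ[ZMod 2] V) (g : P × ZMod 2 →ₗ[ZMod 2] E) :
    P × ZMod 2 →ₗ[ZMod 2] V × ZMod 2 × E :=
  (f ∘ₗ LinearMap.fst _ _ _).prod ((LinearMap.snd _ _ _).prod g)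

theorem pointLift_map_fst_le (f : P →ₗ[ZMod 2] V) (g : P × ZMod 2 →ₗ[ZMod 2] E) :
    (LinearMap.range (pointLift f g)).map (LinearMap.fst (ZMod 2) V (ZMod 2 × E)) ≤
      LinearMap.range f := by
  rintro _ ⟨_, ⟨v, rfl⟩, rfl⟩
  exact ⟨v.1, rfl⟩

theorem pointLift_inf_ker_fst_le {f : P →ₗ[ZMod 2] V} (hf : Function.Injective f)
    (g : P × ZMod 2 →ₗ[ZMod 2] E) :
    LinearMap.range (pointLift f g) ⊓ LinearMap.ker (LinearMap.fst (ZMod 2) V (ZMod 2 × E)) ≤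
      LinearMap.range (pointLift f g ∘ₗ LinearMap.inr (ZMod 2) P (ZMod 2)) := by
  rintro _ ⟨⟨⟨v, s⟩, rfl⟩, hv⟩
  obtain rfl : v = 0 := (map_eq_zero_iff f hf).1 hv
  exact ⟨s, rfl⟩

variable [FiniteDimensional (ZMod 2) V] [FiniteDimensional (ZMod 2) E]

theorem finrank_graphOn_inf_le (c : Submodule (ZMod 2) V) (f : c →ₗ[ZMod 2] E)
    (Y : Submodule (ZMod 2) (V × E)) : finrank (ZMod 2) ↥(graphOn c f ⊓ Y) ≤
      finrank (ZMod 2) ↥(c ⊓ Y.map (LinearMap.fst (ZMod 2) V E)) := by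
  have h := finrank_le_of_map_le_of_inf_ker_le (Z := graphOn c f ⊓ Y) (B := ⊥)
    (Submodule.map_inf_le (LinearMap.fst (ZMod 2) V E))
    ((inf_le_inf_right _ inf_le_left).trans (graphOn_inf_ker_fst c f).le)
  rwa [finrank_bot, add_zero, graphOn_map_fst] at h

/-- Lifting the members of a code by a rank-metric code. -/
theorem exists_lifted_code {ι : Type*} {c : ι → Submodule (ZMod 2) V} (hc : IsCode c)
    {m : ℕ} (hE : finrank (ZMod 2) E = m) (hm : 4 ≤ m) :
    ∃ R : ∀ i, Fin (2 ^ (3 * m)) → c i →ₗ[ZMod 2] E,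
      IsCode fun x : ι × Fin (2 ^ (3 * m)) => graphOn (c x.1) (R x.1 x.2) := by
  choose R hR using fun i => exists_rankCode (c i) E hE (by omega) ((hc.1 i).trans_le hm)
  refine ⟨R, fun x => (finrank_graphOn _ _).trans (hc.1 _), ?_⟩
  rintro ⟨i, r⟩ ⟨j, s⟩ hij
  by_cases h : i = j
  · subst h
    refine (finrank_range_inf_range_le fun v w hvw => ?_).trans
      (hR i r s fun h => hij (h ▸ rfl))
    obtain rfl : v = w := Subtype.ext (congrArg Prod.fst hvw)
    exact sub_eq_zero.2 (congrArg Prod.snd hvw)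
  · refine (finrank_graphOn_inf_le _ _ _).trans ?_
    rw [graphOn_map_fst]
    exact hc.2 i j h

/-- Lifting three-dimensional spaces that meet pairwise in at most a point. -/
theorem exists_pointLift_code {δ : Type*} [FiniteDimensional (ZMod 2) P]
    (hP : finrank (ZMod 2) P = 3) {f : δ → P →ₗ[ZMod 2] V} (hf : ∀ d, Function.Injective (f d))
    (hinf : ∀ d e, d ≠ e →
      finrank (ZMod 2) ↥(LinearMap.range (f d) ⊓ LinearMap.range (f e)) ≤ 1)
    {m : ℕ} (hE : finrank (ZMod 2) E = m) (hm : 4 ≤ m) :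
    ∃ R : Fin (2 ^ (3 * m)) → P × ZMod 2 →ₗ[ZMod 2] E,
      IsCode fun x : δ × Fin (2 ^ (3 * m)) =>
        LinearMap.range (pointLift (f x.1) (R x.2)) := by
  have hP' : finrank (ZMod 2) (P × ZMod 2) = 4 := by simp [hP]
  obtain ⟨R, hR⟩ := exists_rankCode (P × ZMod 2) E hE (by omega) (hP'.trans_le hm)
  refine ⟨R, fun x => (LinearMap.finrank_range_of_inj fun v w h => ?_).trans hP', ?_⟩
  · exact Prod.ext (hf _ (congrArg Prod.fst h)) (congrArg (fun y => y.2.1) h)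
  rintro ⟨d, r⟩ ⟨e, s⟩ hde
  by_cases h : d = e
  · subst h
    refine (finrank_range_inf_range_le fun v w hvw => ?_).trans
      (hR r s fun h => hde (h ▸ rfl))
    obtain rfl : v = w :=
      Prod.ext (hf _ (congrArg Prod.fst hvw)) (congrArg (fun y => y.2.1) hvw)
    exact sub_eq_zero.2 (congrArg (fun y => y.2.2) hvw)
  · have hmap := (Submodule.map_inf_le (LinearMap.fst (ZMod 2) V (ZMod 2 × E))).trans
      (inf_le_inf (pointLift_map_fst_le (f d) (R r)) (pointLift_map_fst_le (f e) (R s)))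
    have hker := (inf_le_inf_right (LinearMap.ker (LinearMap.fst (ZMod 2) V (ZMod 2 × E)))
      (inf_le_left (b := LinearMap.range (pointLift (f e) (R s))))).trans
      (pointLift_inf_ker_fst_le (hf d) (R r))
    have hpoint := LinearMap.finrank_range_le
      (pointLift (f d) (R r) ∘ₗ LinearMap.inr (ZMod 2) P (ZMod 2))
    rw [finrank_self] at hpoint
    exact (finrank_le_of_map_le_of_inf_ker_le hmap hker).trans
      (add_le_add (hinf d e h) hpoint)

/-- A code `c` together with three-dimensional spaces contained in no member of `c` and meeting
pairwise in at most a point gives a code in a larger space. -/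
theorem exists_linked_code {ι δ : Type*} [FiniteDimensional (ZMod 2) P]
    {c : ι → Submodule (ZMod 2) V} (hc : IsCode c)
    (hP : finrank (ZMod 2) P = 3) {f : δ → P →ₗ[ZMod 2] V} (hf : ∀ d, Function.Injective (f d))
    (hinf : ∀ d e, d ≠ e →
      finrank (ZMod 2) ↥(LinearMap.range (f d) ⊓ LinearMap.range (f e)) ≤ 1)
    (hcf : ∀ d i, ¬ LinearMap.range (f d) ≤ c i) {m : ℕ} (hE : finrank (ZMod 2) E = m)
    (hm : 4 ≤ m) :
    ∃ X : (ι × Fin (2 ^ (3 * (m + 1)))) ⊕ (δ × Fin (2 ^ (3 * m))) →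
      Submodule (ZMod 2) (V × ZMod 2 × E), IsCode X := by
  have hE' : finrank (ZMod 2) (ZMod 2 × E) = m + 1 := by simp [hE, add_comm]
  obtain ⟨R, hR⟩ := exists_lifted_code hc hE' (by omega)
  obtain ⟨S, hS⟩ := exists_pointLift_code hP hf hinf hE hm
  refine ⟨_, hR.sum hS fun x y => (finrank_graphOn_inf_le _ _ _).trans ?_⟩
  refine (Submodule.finrank_mono (inf_le_inf_left _ (pointLift_map_fst_le _ _))).trans ?_
  have h := finrank_inf_lt (hcf y.1 x.1)
  rw [LinearMap.finrank_range_of_inj (hf y.1), hP, inf_comm] at h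
  omega

end Linkage

section LengthEight

theorem lineMap_injective (i : Fin 7) (j : Fin 5) : Function.Injective (lineMap i j) :=
  (injective_iff_map_eq_zero _).2 (lineMap_eq_zero i j)

theorem finrank_range_lineMap (i : Fin 7) (j : Fin 5) :
    finrank (ZMod 2) (LinearMap.range (lineMap i j)) = 2 := by
  rw [LinearMap.finrank_range_of_inj (lineMap_injective i j)]
  simp

theorem range_lineMap_inf_eq_bot (i : Fin 7) {j k : Fin 5} (h : j ≠ k) :
    LinearMap.range (lineMap i j) ⊓ LinearMap.range (lineMap i k) = ⊥ := by
  rw [eq_bot_iff]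
  rintro _ ⟨⟨s, rfl⟩, ⟨t, ht⟩⟩
  simp [lineMap_spread i j k h s t ht.symm]

theorem finrank_range_lineMap_inf_le_one {i j : Fin 7} (h : i ≠ j) (k l : Fin 5) :
    finrank (ZMod 2) ↥(LinearMap.range (lineMap i k) ⊓ LinearMap.range (lineMap j l)) ≤ 1 := by
  have hlt := finrank_inf_lt (K := ZMod 2) (X := LinearMap.range (lineMap i k))
    (Y := LinearMap.range (lineMap j l)) fun hle => by
      obtain ⟨s, hs⟩ := lineMap_parallelism i j h k l
      obtain ⟨t, ht⟩ := hle ⟨s, rfl⟩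
      exact hs t ht.symm
  rw [finrank_range_lineMap] at hlt
  omega

/-- The coset construction: the lines `x.2.1` and `x.2.2.1` of the spread `x.1` are combined by
means of the map `cosetMap`. -/
def cosetWord (x : Fin 7 × Fin 5 × Fin 5 × Fin 4) :
    (ZMod 2 × ZMod 2) × (ZMod 2 × ZMod 2) →ₗ[ZMod 2] (Fin 4 → ZMod 2) × (Fin 4 → ZMod 2) :=
  (lineMap x.1 x.2.1 ∘ₗ LinearMap.fst _ _ _).prod
    ((cosetMap x.1 x.2.2.1 x.2.2.2).coprod (lineMap x.1 x.2.2.1))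

theorem cosetWord_apply (x : Fin 7 × Fin 5 × Fin 5 × Fin 4)
    (v : (ZMod 2 × ZMod 2) × (ZMod 2 × ZMod 2)) : cosetWord x v =
      (lineMap x.1 x.2.1 v.1,
        cosetMap x.1 x.2.2.1 x.2.2.2 v.1 + lineMap x.1 x.2.2.1 v.2) := rfl

theorem cosetWord_map_fst_le (x : Fin 7 × Fin 5 × Fin 5 × Fin 4) :
    (LinearMap.range (cosetWord x)).map (LinearMap.fst (ZMod 2) _ _) ≤
      LinearMap.range (lineMap x.1 x.2.1) := by
  rintro _ ⟨_, ⟨v, rfl⟩, rfl⟩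
  exact ⟨v.1, rfl⟩

theorem mem_range_lineMap_of_mem_cosetWord {x : Fin 7 × Fin 5 × Fin 5 × Fin 4}
    {y : Fin 4 → ZMod 2} (h : (0, y) ∈ LinearMap.range (cosetWord x)) :
    y ∈ LinearMap.range (lineMap x.1 x.2.2.1) := by
  obtain ⟨⟨s, t⟩, hst⟩ := h
  rw [cosetWord_apply] at hst
  obtain rfl : s = 0 := lineMap_eq_zero _ _ _ (congrArg Prod.fst hst)
  have h2 := congrArg Prod.snd hst
  simp only [map_zero, zero_add] at h2
  exact ⟨t, h2⟩

theorem finrank_cosetWord_inf_le (x y : Fin 7 × Fin 5 × Fin 5 × Fin 4) :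
    finrank (ZMod 2) ↥(LinearMap.range (cosetWord x) ⊓ LinearMap.range (cosetWord y)) ≤
      finrank (ZMod 2) ↥(LinearMap.range (lineMap x.1 x.2.1) ⊓
        LinearMap.range (lineMap y.1 y.2.1)) +
      finrank (ZMod 2) ↥(LinearMap.range (lineMap x.1 x.2.2.1) ⊓
        LinearMap.range (lineMap y.1 y.2.2.1)) := by
  refine (finrank_le_of_map_le_of_inf_ker_le (g := LinearMap.fst (ZMod 2) _ _)
    (B := (LinearMap.range (lineMap x.1 x.2.2.1) ⊓
      LinearMap.range (lineMap y.1 y.2.2.1)).map (LinearMap.inr (ZMod 2) (Fin 4 → ZMod 2) _))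
    ((Submodule.map_inf_le _).trans
      (inf_le_inf (cosetWord_map_fst_le x) (cosetWord_map_fst_le y))) ?_).trans
    (Nat.add_le_add_left (Submodule.finrank_map_le _ _) _)
  rintro ⟨a, b⟩ ⟨⟨hx, hy⟩, ha⟩
  obtain rfl : a = 0 := ha
  exact ⟨b, ⟨mem_range_lineMap_of_mem_cosetWord hx, mem_range_lineMap_of_mem_cosetWord hy⟩, rfl⟩

theorem cosetWord_injective (x : Fin 7 × Fin 5 × Fin 5 × Fin 4) :
    Function.Injective (cosetWord x) := by
  refine (injective_iff_map_eq_zero _).2 ?_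
  rintro ⟨s, t⟩ h
  rw [cosetWord_apply] at h
  obtain rfl : s = 0 := lineMap_eq_zero _ _ _ (congrArg Prod.fst h)
  have h2 := congrArg Prod.snd h
  simp only [map_zero, zero_add, Prod.snd_zero] at h2
  exact Prod.ext rfl (lineMap_eq_zero _ _ _ h2)

theorem isCode_cosetWord : IsCode fun x => LinearMap.range (cosetWord x) := by
  refine ⟨fun x => (LinearMap.finrank_range_of_inj (cosetWord_injective x)).trans (by simp), ?_⟩
  rintro ⟨i, j, k, m⟩ ⟨i', j', k', m'⟩ hne
  by_cases hi : i = i'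
  · subst hi
    by_cases hj : j = j'
    · subst hj
      by_cases hk : k = k'
      · subst hk
        have hm : m ≠ m' := fun h => hne (h ▸ rfl)
        refine (finrank_range_inf_range_le
          (N := LinearMap.range (LinearMap.inr (ZMod 2) (ZMod 2 × ZMod 2) (ZMod 2 × ZMod 2)))
          fun v w hvw => ?_).trans ((LinearMap.finrank_range_le _).trans (by simp))
        rw [cosetWord_apply, cosetWord_apply] at hvw
        have h1 : v.1 = w.1 := lineMap_injective _ _ (congrArg Prod.fst hvw)
        have h2 : cosetMap i k m v.1 + lineMap i k v.2 = cosetMap i k m' w.1 + lineMap i k w.2 :=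
          congrArg Prod.snd hvw
        have h3 : w.1 = 0 := cosetMap_rank i k m' m hm.symm w.1 (v.2 - w.2) (by
          rw [map_sub, ← add_sub_assoc, eq_sub_iff_add_eq, ← h2, h1])
        exact ⟨w.2, Prod.ext h3.symm rfl⟩
      · refine (finrank_cosetWord_inf_le _ _).trans ?_
        rw [range_lineMap_inf_eq_bot i hk, finrank_bot, inf_idem, finrank_range_lineMap]
    · refine (finrank_cosetWord_inf_le _ _).trans ?_
      rw [range_lineMap_inf_eq_bot i hj, finrank_bot, zero_add]
      exact (Submodule.finrank_mono inf_le_left).trans (finrank_range_lineMap i k).le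
  · exact (finrank_cosetWord_inf_le _ _).trans (add_le_add
      (finrank_range_lineMap_inf_le_one hi _ _) (finrank_range_lineMap_inf_le_one hi _ _))

/-- Three-dimensional spaces contained in no space of the coset construction. -/
def planeWord (d : Fin 5 × Fin 15) :
    (ZMod 2 × ZMod 2) × ZMod 2 →ₗ[ZMod 2] (Fin 4 → ZMod 2) × (Fin 4 → ZMod 2) :=
  (lineMap 0 d.1 ∘ₗ LinearMap.fst _ _ _).prod
    ((planeMap d.2).coprod (LinearMap.toSpanSingleton (ZMod 2) _ (point d.2)))

theorem planeWord_apply (d : Fin 5 × Fin 15) (v : (ZMod 2 × ZMod 2) × ZMod 2) :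
    planeWord d v = (lineMap 0 d.1 v.1, planeMap d.2 v.1 + v.2 • point d.2) := rfl

theorem point_mem_planeWord (d : Fin 5 × Fin 15) :
    (0, point d.2) ∈ LinearMap.range (planeWord d) :=
  ⟨(0, 1), by simp [planeWord_apply]⟩

theorem planeWord_injective (d : Fin 5 × Fin 15) : Function.Injective (planeWord d) := by
  refine (injective_iff_map_eq_zero _).2 ?_
  rintro ⟨s, t⟩ h
  rw [planeWord_apply] at h
  obtain rfl : s = 0 := lineMap_eq_zero _ _ _ (congrArg Prod.fst h)
  have h2 := congrArg Prod.snd h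
  simp only [map_zero, zero_add, Prod.snd_zero] at h2
  exact Prod.ext rfl ((smul_eq_zero.1 h2).resolve_right (point_ne_zero d.2))

theorem planeWord_map_fst_le (d : Fin 5 × Fin 15) :
    (LinearMap.range (planeWord d)).map (LinearMap.fst (ZMod 2) _ _) ≤
      LinearMap.range (lineMap 0 d.1) := by
  rintro _ ⟨_, ⟨v, rfl⟩, rfl⟩
  exact ⟨v.1, rfl⟩

theorem exists_eq_smul_of_mem_planeWord {d : Fin 5 × Fin 15} {y : Fin 4 → ZMod 2}
    (h : (0, y) ∈ LinearMap.range (planeWord d)) : ∃ t : ZMod 2, y = t • point d.2 := by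
  obtain ⟨⟨s, t⟩, hst⟩ := h
  rw [planeWord_apply] at hst
  obtain rfl : s = 0 := lineMap_eq_zero _ _ _ (congrArg Prod.fst hst)
  have h2 := congrArg Prod.snd hst
  simp only [map_zero, zero_add] at h2
  exact ⟨t, h2.symm⟩

theorem finrank_planeWord_inf_le_one {d e : Fin 5 × Fin 15} (hde : d ≠ e) :
    finrank (ZMod 2) ↥(LinearMap.range (planeWord d) ⊓ LinearMap.range (planeWord e)) ≤ 1 := by
  have hmap := (Submodule.map_inf_le (p := LinearMap.range (planeWord d))
    (q := LinearMap.range (planeWord e)) (LinearMap.fst (ZMod 2) _ _)).trans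
      (inf_le_inf (planeWord_map_fst_le d) (planeWord_map_fst_le e))
  by_cases h : d.1 = e.1
  · have hpq : d.2 ≠ e.2 := fun h' => hde (Prod.ext h h')
    have hker : LinearMap.range (planeWord d) ⊓ LinearMap.range (planeWord e) ⊓
        LinearMap.ker (LinearMap.fst (ZMod 2) _ _) = ⊥ := by
      rw [eq_bot_iff]
      rintro ⟨a, b⟩ ⟨⟨hd, he⟩, ha⟩
      obtain rfl : a = 0 := ha
      obtain ⟨s, rfl⟩ := exists_eq_smul_of_mem_planeWord hd
      obtain ⟨t, ht⟩ := exists_eq_smul_of_mem_planeWord he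
      simp [point_independent _ _ hpq s t ht]
    rw [finrank_eq_map_add_inf_ker (LinearMap.fst (ZMod 2) _ _), hker, finrank_bot, add_zero]
    have hlt := Submodule.finrank_lt_finrank_of_lt
      (lt_of_le_of_ne (hmap.trans inf_le_left) fun heq => by
        obtain ⟨s, hs⟩ := planeMap_separated d.2 e.2 hpq
        have hmem : lineMap 0 d.1 s ∈ LinearMap.range (lineMap 0 d.1) := ⟨s, rfl⟩
        rw [← heq] at hmem
        obtain ⟨⟨_, b⟩, ⟨⟨v, hv⟩, ⟨w, hw⟩⟩, rfl⟩ := hmem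
        rw [planeWord_apply] at hv hw
        have hvs : v.1 = s := lineMap_injective _ _ (congrArg Prod.fst hv)
        have hws : w.1 = s := lineMap_injective 0 d.1 (h ▸ congrArg Prod.fst hw)
        have h2 := congrArg Prod.snd (hv.trans hw.symm)
        rw [hvs, hws] at h2
        exact hs _ _ h2)
    rw [finrank_range_lineMap] at hlt
    omega
  · rw [range_lineMap_inf_eq_bot 0 h] at hmap
    refine (finrank_le_of_map_le_of_inf_ker_le hmap (B := LinearMap.range
      (LinearMap.toSpanSingleton (ZMod 2) ((Fin 4 → ZMod 2) × (Fin 4 → ZMod 2))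
        (0, point d.2))) ?_).trans ?_
    · rintro ⟨a, b⟩ ⟨⟨hd, -⟩, ha⟩
      obtain rfl : a = 0 := ha
      obtain ⟨s, rfl⟩ := exists_eq_smul_of_mem_planeWord hd
      exact ⟨s, by simp⟩
    · rw [finrank_bot, zero_add]
      exact (LinearMap.finrank_range_le _).trans (finrank_self _).le

theorem planeWord_not_le_cosetWord (d : Fin 5 × Fin 15) (x : Fin 7 × Fin 5 × Fin 5 × Fin 4) :
    ¬ LinearMap.range (planeWord d) ≤ LinearMap.range (cosetWord x) := by
  intro hle
  obtain ⟨i, j, k, m⟩ := x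
  have hfst (s : ZMod 2 × ZMod 2) : ∃ v, lineMap i j v = lineMap 0 d.1 s ∧
      ∃ t, cosetMap i k m v + lineMap i k t = planeMap d.2 s := by
    obtain ⟨v, hv⟩ := hle ⟨(s, 0), rfl⟩
    rw [planeWord_apply, cosetWord_apply, zero_smul, add_zero] at hv
    exact ⟨v.1, congrArg Prod.fst hv, v.2, congrArg Prod.snd hv⟩
  obtain rfl : 0 = i := by
    by_contra h
    obtain ⟨s, hs⟩ := lineMap_parallelism 0 i h d.1 j
    obtain ⟨v, hv, -⟩ := hfst s
    exact hs v hv.symm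
  obtain rfl : d.1 = j := by
    by_contra h
    obtain ⟨v, hv, -⟩ := hfst (1, 0)
    exact absurd (lineMap_spread 0 d.1 j h _ _ hv.symm) (by decide)
  obtain ⟨t, ht⟩ := mem_range_lineMap_of_mem_cosetWord (hle (point_mem_planeWord d))
  obtain ⟨s, hs⟩ := planeMap_uncovered d.2 k t ht m
  obtain ⟨v, hv, u, hu⟩ := hfst s
  obtain rfl := lineMap_injective _ _ hv
  exact hs u hu.symm

/-- A code of `4796` four-dimensional subspaces of `F_2^8`, none of which contains one of the
spaces `planeWord d`. -/
theorem exists_code_eight :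
    ∃ c : Fin (2 ^ 12) ⊕ (Fin 7 × Fin 5 × Fin 5 × Fin 4) →
      Submodule (ZMod 2) ((Fin 4 → ZMod 2) × (Fin 4 → ZMod 2)),
      IsCode c ∧ ∀ d i, ¬ LinearMap.range (planeWord d) ≤ c i := by
  obtain ⟨R, hR⟩ := exists_rankCode (Fin 4 → ZMod 2) (Fin 4 → ZMod 2) (m := 4) (by simp)
    (by simp) (by simp)
  let g (r : Fin (2 ^ 12)) : (Fin 4 → ZMod 2) →ₗ[ZMod 2] (Fin 4 → ZMod 2) × (Fin 4 → ZMod 2) :=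
    LinearMap.id.prod (R r)
  have hker (r) : LinearMap.range (g r) ⊓
      LinearMap.ker (LinearMap.fst (ZMod 2) (Fin 4 → ZMod 2) (Fin 4 → ZMod 2)) = ⊥ := by
    rw [eq_bot_iff]
    rintro _ ⟨⟨v, rfl⟩, hv⟩
    obtain rfl : v = 0 := hv
    simp
  have hg : IsCode fun r => LinearMap.range (g r) := by
    refine ⟨fun r => (LinearMap.finrank_range_of_inj fun _ _ h => congrArg Prod.fst h).trans
      (by simp), fun r s hrs => (finrank_range_inf_range_le fun v w hvw => ?_).trans (hR r s hrs)⟩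
    obtain rfl : v = w := congrArg Prod.fst hvw
    exact sub_eq_zero.2 (congrArg Prod.snd hvw)
  refine ⟨_, hg.sum isCode_cosetWord fun r x => ?_, ?_⟩
  · have h := finrank_le_of_map_le_of_inf_ker_le
      ((Submodule.map_mono inf_le_right).trans (cosetWord_map_fst_le x))
      ((inf_le_inf_right _ inf_le_left).trans (hker r).le)
    rwa [finrank_bot, finrank_range_lineMap] at h
  · rintro d (r | x) hle
    · have h : ((0 : Fin 4 → ZMod 2), point d.2) ∈ (⊥ : Submodule (ZMod 2) _) := by
        rw [← hker r]
        exact ⟨hle (point_mem_planeWord d), rfl⟩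
      exact point_ne_zero d.2 (congrArg Prod.snd h)
    · exact planeWord_not_le_cosetWord d x hle

end LengthEight

theorem IsCode.four_le_subspaceDist {ι V : Type*} [AddCommGroup V] [Module (ZMod 2) V]
    [FiniteDimensional (ZMod 2) V] {X : ι → Submodule (ZMod 2) V} (hX : IsCode X) {i j : ι}
    (h : i ≠ j) : 4 ≤ subspaceDist (X i) (X j) := by
  have h1 := Submodule.finrank_sup_add_finrank_inf_eq (X i) (X j)
  have h2 := hX.2 i j h
  rw [hX.1, hX.1] at h1
  rw [subspaceDist, hX.1, hX.1]
  omega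

theorem IsCode.injective {ι V : Type*} [AddCommGroup V] [Module (ZMod 2) V]
    {X : ι → Submodule (ZMod 2) V} (hX : IsCode X) : Function.Injective X := by
  intro i j h
  by_contra hij
  have h2 := hX.2 i j hij
  rw [← h, inf_idem, hX.1] at h2
  omega

theorem IsCode.map_equiv {ι V W : Type*} [AddCommGroup V] [Module (ZMod 2) V] [AddCommGroup W]
    [Module (ZMod 2) W] {X : ι → Submodule (ZMod 2) V} (hX : IsCode X) (e : V ≃ₗ[ZMod 2] W) :
    IsCode fun i => (X i).map e.toLinearMap := by
  refine ⟨fun i => (LinearEquiv.finrank_map_eq e _).trans (hX.1 i), fun i j hij => ?_⟩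
  rw [← Submodule.map_inf _ e.injective]
  exact (LinearEquiv.finrank_map_eq e _).trans_le (hX.2 i j hij)

theorem statement15 :
    ∃ S : Set (Submodule (ZMod 2) (Fin 15 → ZMod 2)),
      S.ncard = 10073479745 ∧
      (∀ X ∈ S, Module.finrank (ZMod 2) ↥X = 4) ∧
      (∀ X ∈ S, ∀ Y ∈ S, X ≠ Y → 4 ≤ subspaceDist X Y) := by
  obtain ⟨c, hc, hcd⟩ := exists_code_eight
  obtain ⟨X, hX⟩ := exists_linked_code (E := Fin 6 → ZMod 2) hc (by simp) planeWord_injective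
    (fun _ _ => finrank_planeWord_inf_le_one) hcd (m := 6) (by simp) (by norm_num)
  have hfinrank : finrank (ZMod 2)
      (((Fin 4 → ZMod 2) × (Fin 4 → ZMod 2)) × ZMod 2 × (Fin 6 → ZMod 2)) =
        finrank (ZMod 2) (Fin 15 → ZMod 2) := by
    simp
  let e := LinearEquiv.ofFinrankEq _ _ hfinrank
  have hY := hX.map_equiv e
  have hcard : 10073479745 ≤ (Set.range fun i => (X i).map e.toLinearMap).ncard := by
    rw [← Set.image_univ, Set.ncard_image_of_injective _ hY.injective, Set.ncard_univ]
    simp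
  obtain ⟨S, hS, hcardS⟩ := Set.exists_subset_card_eq hcard
  refine ⟨S, hcardS, fun Z hZ => ?_, fun Z hZ Z' hZ' hne => ?_⟩
  · obtain ⟨i, rfl⟩ := hS hZ
    exact hY.1 i
  · obtain ⟨i, rfl⟩ := hS hZ
    obtain ⟨j, rfl⟩ := hS hZ'
    exact hY.four_le_subspaceDist fun h => hne (h ▸ rfl)
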